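/- With Θ the context-free grammar constructed from a confluent context-free monadic rewriting system (A,R): if w ∈ L(Θ), then w = u #₂ vʳᵉᵛ for some u, v ∈ A*, and there exists p ∈ A* such that $_p ⇒*_Θ u and $̃_{pʳᵉᵛ} ⇒*_Θ vʳᵉᵛ. -/

import Mathlib

/-! Common framework: string rewriting systems and the grammar Θ constructed from a
confluent context-free monadic rewriting system `(A, R)`. -/

/-- Words over the alphabet `A`. -/
abbrev Word (A : Type) : Type := List A

/-- The word (of length at most one) corresponding to an element of `A ∪ {ε}`. -/
def toWord {A : Type} (a : Option A) : Word A := a.elim [] (fun b => [b])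

/-- One rewriting step of the string rewriting system `R`. -/
def RWStep {A : Type} (R : Set (Word A × Word A)) (u v : Word A) : Prop :=
  ∃ (x y l r : Word A), (l, r) ∈ R ∧ u = x ++ l ++ y ∧ v = x ++ r ++ y

/-- The reduction relation `⇒*_R`. -/
abbrev RWDerives {A : Type} (R : Set (Word A × Word A)) : Word A → Word A → Prop :=
  Relation.ReflTransGen (RWStep R)

/-- Equality in the monoid presented by `⟨A | R⟩`. -/
abbrev MonEq {A : Type} (R : Set (Word A × Word A)) : Word A → Word A → Prop :=
  Relation.EqvGen (RWStep R)

/-- Confluence of the rewriting system. -/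
def RWConfluent {A : Type} (R : Set (Word A × Word A)) : Prop :=
  ∀ u u' u'' : Word A, RWDerives R u u' → RWDerives R u u'' →
    ∃ v : Word A, RWDerives R u' v ∧ RWDerives R u'' v

/-- Monadic: length-reducing with right-hand sides in `A ∪ {ε}`. -/
def RWMonadic {A : Type} (R : Set (Word A × Word A)) : Prop :=
  ∀ p ∈ R, p.2.length < p.1.length ∧ p.2.length ≤ 1

/-- Terminal alphabet of the auxiliary grammar `Δ`:
the symbols `$_a`, `$̃_a` (for `a ∈ A ∪ {ε}`) together with `#₂`. -/
inductive DollarT (A : Type) : Type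
  | dol : Option A → DollarT A
  | tdol : Option A → DollarT A
  | hash : DollarT A

/-- `$_p` as a word over `DollarT A`: `$_{p₁}⋯$_{p_n}` for `p ≠ ε`,
and the single letter `$_ε` for `p = ε`. -/
def dW {A : Type} : Word A → List (DollarT A)
  | [] => [DollarT.dol none]
  | p => p.map (fun b => DollarT.dol (some b))

/-- `$̃_p` as a word over `DollarT A`. -/
def tdW {A : Type} : Word A → List (DollarT A)
  | [] => [DollarT.tdol none]
  | p => p.map (fun b => DollarT.tdol (some b))

/-- Nonterminals of `Θ`: the nonterminals of `Δ`, the symbols `$_a` and `$̃_a`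
(`a ∈ A ∪ {ε}`), and the (pairwise disjoint) nonterminals of the grammars `Γ'_a`
and `Γ''_a`. -/
inductive ThetaNT (A : Type) (Γ : Option A → ContextFreeGrammar.{0} A)
    (Δ : ContextFreeGrammar.{0} (DollarT A)) : Type
  | delta : Δ.NT → ThetaNT A Γ Δ
  | dol : Option A → ThetaNT A Γ Δ
  | tdol : Option A → ThetaNT A Γ Δ
  | prime : (a : Option A) → (Γ a).NT → ThetaNT A Γ Δ
  | dprime : (a : Option A) → (Γ a).NT → ThetaNT A Γ Δ

variable {A : Type} (Γ : Option A → ContextFreeGrammar.{0} A)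
  (Δ : ContextFreeGrammar.{0} (DollarT A))

/-- Translation of symbols of `Γ_a` into symbols of `Θ`, realising `Γ'_a`:
each terminal `b` is replaced by the nonterminal `$_b`. -/
def primeSym (a : Option A) : Symbol A (Γ a).NT → Symbol (Option A) (ThetaNT A Γ Δ)
  | Symbol.terminal b => Symbol.nonterminal (ThetaNT.dol (some b))
  | Symbol.nonterminal n => Symbol.nonterminal (ThetaNT.prime a n)

/-- Translation of symbols of `Γ_a` into symbols of `Θ`, realising `Γ''_a`:
each terminal `b` is replaced by the nonterminal `$̃_b`. -/
def dprimeSym (a : Option A) : Symbol A (Γ a).NT → Symbol (Option A) (ThetaNT A Γ Δ)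
  | Symbol.terminal b => Symbol.nonterminal (ThetaNT.tdol (some b))
  | Symbol.nonterminal n => Symbol.nonterminal (ThetaNT.dprime a n)

/-- Translation of symbols of `Δ` into symbols of `Θ`: the terminals `$_a`, `$̃_a`
of `Δ` become nonterminals of `Θ`, and `#₂` stays a terminal (encoded as `none`). -/
def deltaSym : Symbol (DollarT A) Δ.NT → Symbol (Option A) (ThetaNT A Γ Δ)
  | Symbol.terminal (DollarT.dol a) => Symbol.nonterminal (ThetaNT.dol a)
  | Symbol.terminal (DollarT.tdol a) => Symbol.nonterminal (ThetaNT.tdol a)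
  | Symbol.terminal DollarT.hash => Symbol.terminal none
  | Symbol.nonterminal n => Symbol.nonterminal (ThetaNT.delta n)

/-- The productions of `Θ`: those of `Δ`, those of all `Γ'_a` and `Γ''_a`, the insertion
productions `$_a → $_a $_ε`, `$_a → $_ε $_a`, `$̃_a → $̃_a $̃_ε`, `$̃_a → $̃_ε $̃_a`, the
start productions `$_a → O'_a`, `$̃_a → O''_a`, and the terminal productions
`$_a → a`, `$̃_a → a` (with `$_ε → ε`, `$̃_ε → ε`). -/
noncomputable def thetaRules [Fintype A] : List (ContextFreeRule (Option A) (ThetaNT A Γ Δ)) :=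
  (Δ.rules.toList.map (fun r =>
    ⟨ThetaNT.delta r.input, r.output.map (deltaSym Γ Δ)⟩))
  ++ ((Finset.univ : Finset (Option A)).toList.flatMap (fun a =>
      ((Γ a).rules.toList.map (fun r =>
        ⟨ThetaNT.prime a r.input, r.output.map (primeSym Γ Δ a)⟩))
      ++ ((Γ a).rules.toList.map (fun r =>
        ⟨ThetaNT.dprime a r.input, r.output.reverse.map (dprimeSym Γ Δ a)⟩))
      ++ [⟨ThetaNT.dol a, [Symbol.nonterminal (ThetaNT.dol a),
             Symbol.nonterminal (ThetaNT.dol none)]⟩,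
          ⟨ThetaNT.dol a, [Symbol.nonterminal (ThetaNT.dol none),
             Symbol.nonterminal (ThetaNT.dol a)]⟩,
          ⟨ThetaNT.tdol a, [Symbol.nonterminal (ThetaNT.tdol a),
             Symbol.nonterminal (ThetaNT.tdol none)]⟩,
          ⟨ThetaNT.tdol a, [Symbol.nonterminal (ThetaNT.tdol none),
             Symbol.nonterminal (ThetaNT.tdol a)]⟩,
          ⟨ThetaNT.dol a, [Symbol.nonterminal (ThetaNT.prime a (Γ a).initial)]⟩,
          ⟨ThetaNT.tdol a, [Symbol.nonterminal (ThetaNT.dprime a (Γ a).initial)]⟩,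
          ⟨ThetaNT.dol a, (toWord a).map (fun b => Symbol.terminal (some b))⟩,
          ⟨ThetaNT.tdol a, (toWord a).map (fun b => Symbol.terminal (some b))⟩]))

/-- The grammar `Θ`, over the terminal alphabet `A ∪ {#₂}` (encoded as `Option A`
with `none = #₂`), with start symbol `O_Δ`. -/
noncomputable def Theta [Fintype A] : ContextFreeGrammar.{0} (Option A) :=
  { NT := ThetaNT A Γ Δ
    initial := ThetaNT.delta Δ.initial
    rules := @List.toFinset _ (Classical.decEq _) (thetaRules Γ Δ) }

/-- `$_p` as a string of symbols of `Θ` (the single letter `$_ε` when `p = ε`). -/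
def dols : Word A → List (Symbol (Option A) (ThetaNT A Γ Δ))
  | [] => [Symbol.nonterminal (ThetaNT.dol none)]
  | p => p.map (fun b => Symbol.nonterminal (ThetaNT.dol (some b)))

/-- `$̃_p` as a string of symbols of `Θ` (the single letter `$̃_ε` when `p = ε`). -/
def tdols : Word A → List (Symbol (Option A) (ThetaNT A Γ Δ))
  | [] => [Symbol.nonterminal (ThetaNT.tdol none)]
  | p => p.map (fun b => Symbol.nonterminal (ThetaNT.tdol (some b)))

/-- A word over `A` as a string of terminal symbols of `Θ`. -/
def terms : Word A → List (Symbol (Option A) (ThetaNT A Γ Δ)) :=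
  fun u => u.map (fun b => Symbol.terminal (some b))

namespace ContextFreeGrammar

/-- A derivation from a concatenation splits into derivations from the two factors. -/
lemma Derives.exists_append {T : Type*} {g : ContextFreeGrammar T}
    {u v w : List (Symbol T g.NT)} (h : g.Derives (u ++ v) w) :
    ∃ w₁ w₂, w = w₁ ++ w₂ ∧ g.Derives u w₁ ∧ g.Derives v w₂ := by
  induction h with
  | refl => exact ⟨u, v, rfl, .refl u, .refl v⟩
  | tail _ last ih =>
    obtain ⟨w₁, w₂, rfl, h₁, h₂⟩ := ih
    obtain ⟨r, hr, hrw⟩ := last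
    obtain ⟨p, q, hpq, rfl⟩ := hrw.exists_parts
    rw [List.append_assoc, List.append_eq_append_iff] at hpq
    rcases hpq with ⟨a, rfl, ha⟩ | ⟨c, rfl, hc⟩
    · refine ⟨w₁, a ++ r.output ++ q, by simp, h₁, h₂.trans_produces ⟨r, hr, ?_⟩⟩
      subst ha
      simpa using r.rewrites_of_exists_parts a q
    · rcases c with _ | ⟨x, c⟩
      · refine ⟨p, r.output ++ q, by simp, by simpa using h₁,
          h₂.trans_produces ⟨r, hr, ?_⟩⟩
        have hc' : w₂ = Symbol.nonterminal r.input :: q := by simpa using hc.symm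
        subst hc'
        exact .head q
      · simp only [List.cons_append, List.cons.injEq] at hc
        obtain ⟨rfl, rfl⟩ := hc
        refine ⟨p ++ r.output ++ c, w₂, by simp, h₁.trans_produces ⟨r, hr, ?_⟩, h₂⟩
        simpa using r.rewrites_of_exists_parts p c

/-- A set of symbols closed under the productions is preserved by derivations. -/
lemma Derives.forall_mem {T : Type*} {g : ContextFreeGrammar T} {P : Symbol T g.NT → Prop}
    (hP : ∀ r ∈ g.rules, P (.nonterminal r.input) → ∀ s ∈ r.output, P s)
    {u v : List (Symbol T g.NT)} (h : g.Derives u v) (hu : ∀ s ∈ u, P s) : ∀ s ∈ v, P s := by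
  induction h with
  | refl => exact hu
  | tail _ last ih =>
    obtain ⟨r, hr, hrw⟩ := last
    obtain ⟨p, q, rfl, rfl⟩ := hrw.exists_parts
    have := hP r hr (ih _ (by simp))
    intro s hs
    simp only [List.mem_append] at hs ih
    rcases hs with (hs | hs) | hs
    · exact ih s (by simp [hs])
    · exact this s hs
    · exact ih s (by simp [hs])

open Classical in
/-- The grammar keeping only the productions whose left-hand side satisfies `P`. -/
noncomputable def restrict {T : Type*} (g : ContextFreeGrammar T) (P : g.NT → Prop) :
    ContextFreeGrammar T :=
  { NT := g.NT
    initial := g.initial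
    rules := g.rules.filter fun r => P r.input }

open Classical in
lemma restrict_produces_iff {T : Type*} {g : ContextFreeGrammar T} {P : g.NT → Prop}
    {u v : List (Symbol T g.NT)} :
    (g.restrict P).Produces u v ↔ ∃ r ∈ g.rules, P r.input ∧ r.Rewrites u v := by
  constructor
  · rintro ⟨r, hr, h⟩
    obtain ⟨hr, hP⟩ := Finset.mem_filter.1 hr
    exact ⟨r, hr, hP, h⟩
  · rintro ⟨r, hr, hP, h⟩
    exact ⟨r, Finset.mem_filter.2 ⟨hr, hP⟩, h⟩

lemma restrict_derives_eq {T : Type*} {g : ContextFreeGrammar T} {P : g.NT → Prop}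
    {u v : List (Symbol T g.NT)} (h : (g.restrict P).Derives u v)
    (hu : ∀ n, P n → Symbol.nonterminal n ∉ u) : v = u := by
  rcases h.eq_or_head with h | ⟨x, hx, _⟩
  · exact h.symm
  · obtain ⟨r, _, hP, hrw⟩ := restrict_produces_iff.1 hx
    exact absurd hrw.nonterminal_input_mem (hu _ hP)

/-- If the productions of nonterminals outside `P` never create nonterminals in `P`, a derivation
of a string without nonterminals in `P` can be reordered so that the productions
of nonterminals in `P` are all applied first. -/
lemma Derives.exists_restrict {T : Type*} {g : ContextFreeGrammar T} {P : g.NT → Prop}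
    (hP : ∀ r ∈ g.rules, ¬ P r.input → ∀ n, P n → Symbol.nonterminal n ∉ r.output)
    {u w : List (Symbol T g.NT)} (h : g.Derives u w)
    (hw : ∀ n, P n → Symbol.nonterminal n ∉ w) :
    ∃ v : List (Symbol T g.NT), (g.restrict P).Derives u v ∧
      (∀ n, P n → Symbol.nonterminal n ∉ v) ∧ g.Derives v w := by
  induction h using Relation.ReflTransGen.head_induction_on with
  | refl => exact ⟨w, Relation.ReflTransGen.refl, hw, .refl w⟩
  | head first _ ih =>
    obtain ⟨v, hv, hvP, hvw⟩ := ih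
    obtain ⟨r, hr, hrw⟩ := first
    by_cases hPr : P r.input
    · exact ⟨v, (restrict_produces_iff.2 ⟨r, hr, hPr, hrw⟩).trans_derives hv, hvP, hvw⟩
    · obtain ⟨p, q, rfl, rfl⟩ := hrw.exists_parts
      obtain ⟨v₁, q', rfl, h₁, hq⟩ := Derives.exists_append hv
      obtain ⟨p', o, rfl, hp, ho⟩ := Derives.exists_append h₁
      obtain rfl := restrict_derives_eq ho (hP r hr hPr)
      refine ⟨p' ++ [.nonterminal r.input] ++ q', ?_, ?_, ?_⟩
      · exact ((hp.append_right _).append_right _).trans (hq.append_left _)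
      · intro n hn hmem
        rcases List.mem_append.1 hmem with h | h
        · rcases List.mem_append.1 h with h | h
          · exact hvP n hn (List.mem_append_left _ (List.mem_append_left _ h))
          · cases List.mem_singleton.1 h
            exact hPr hn
        · exact hvP n hn (List.mem_append_right _ h)
      · exact Produces.trans_derives ⟨r, hr, r.rewrites_of_exists_parts p' q'⟩ hvw

end ContextFreeGrammar

/-- A nonterminal of `Θ` coming from `Δ`. -/
def ThetaNT.IsDelta {A : Type} {Γ : Option A → ContextFreeGrammar.{0} A}
    {Δ : ContextFreeGrammar.{0} (DollarT A)} (n : ThetaNT A Γ Δ) : Prop :=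
  ∃ m, n = .delta m

/-- A symbol of `Θ` that is neither `#₂` nor a nonterminal of `Δ`. -/
def IsOuterFree {A : Type} {Γ : Option A → ContextFreeGrammar.{0} A}
    {Δ : ContextFreeGrammar.{0} (DollarT A)} (s : Symbol (Option A) (ThetaNT A Γ Δ)) : Prop :=
  s ≠ .terminal none ∧ ∀ m, s ≠ .nonterminal (.delta m)

/-- A production of `Θ` either comes from `Δ`, or its left-hand side is not a nonterminal of `Δ`
and its right-hand side contains neither `#₂` nor a nonterminal of `Δ`. -/
lemma Theta_rules_cases {A : Type} [Fintype A] (Γ : Option A → ContextFreeGrammar.{0} A)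
    (Δ : ContextFreeGrammar.{0} (DollarT A)) {r : ContextFreeRule (Option A) (ThetaNT A Γ Δ)}
    (hr : r ∈ (Theta Γ Δ).rules) :
    (∃ r' ∈ Δ.rules, r = ⟨.delta r'.input, r'.output.map (deltaSym Γ Δ)⟩) ∨
      (¬ r.input.IsDelta ∧ ∀ s ∈ r.output, IsOuterFree s) := by
  have hr' : r ∈ thetaRules Γ Δ := (@List.mem_toFinset _ (Classical.decEq _) _ _).1 hr
  rw [thetaRules, List.mem_append] at hr'
  rcases hr' with h | h
  · obtain ⟨r', hr', rfl⟩ := List.mem_map.1 h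
    exact .inl ⟨r', Finset.mem_toList.1 hr', rfl⟩
  · right
    obtain ⟨a, -, h⟩ := List.mem_flatMap.1 h
    rw [List.mem_append, List.mem_append] at h
    rcases h with (h | h) | h
    · obtain ⟨r', -, rfl⟩ := List.mem_map.1 h
      refine ⟨by simp [ThetaNT.IsDelta], fun s hs => ?_⟩
      obtain ⟨t, -, rfl⟩ := List.mem_map.1 hs
      cases t <;> simp [primeSym, IsOuterFree]
    · obtain ⟨r', -, rfl⟩ := List.mem_map.1 h
      refine ⟨by simp [ThetaNT.IsDelta], fun s hs => ?_⟩
      obtain ⟨t, -, rfl⟩ := List.mem_map.1 hs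
      cases t <;> simp [dprimeSym, IsOuterFree]
    · simp only [List.mem_cons, List.not_mem_nil, or_false] at h
      rcases h with rfl | rfl | rfl | rfl | rfl | rfl | rfl | rfl <;>
        simp [ThetaNT.IsDelta, IsOuterFree]

/-- The productions of `Θ` coming from `Δ` simulate derivations in `Δ`. -/
lemma exists_derives_of_restrict_Theta {A : Type} [Fintype A]
    (Γ : Option A → ContextFreeGrammar.{0} A) (Δ : ContextFreeGrammar.{0} (DollarT A))
    {t : List (Symbol (DollarT A) Δ.NT)} {s : List (Symbol (Option A) (ThetaNT A Γ Δ))}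
    (h : ((Theta Γ Δ).restrict ThetaNT.IsDelta).Derives (t.map (deltaSym Γ Δ)) s) :
    ∃ t', s = t'.map (deltaSym Γ Δ) ∧ Δ.Derives t t' := by
  induction h with
  | refl => exact ⟨t, rfl, .refl t⟩
  | tail _ last ih =>
    obtain ⟨t', rfl, ht⟩ := ih
    obtain ⟨r, hr, hd, hrw⟩ := ContextFreeGrammar.restrict_produces_iff.1 last
    rcases Theta_rules_cases Γ Δ hr with ⟨r', hr', rfl⟩ | h
    · obtain ⟨p, q, hpq, rfl⟩ := hrw.exists_parts
      obtain ⟨l, q, rfl, hl, rfl⟩ := List.map_eq_append_iff.1 hpq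
      obtain ⟨p, m, rfl, rfl, hm⟩ := List.map_eq_append_iff.1 hl
      obtain ⟨x, rfl, hx⟩ := List.map_eq_singleton_iff.1 hm
      obtain rfl : x = .nonterminal r'.input := by
        rcases x with (_ | _ | _) | _ <;> cases hx <;> rfl
      exact ⟨p ++ r'.output ++ q, by rw [List.map_append, List.map_append]; rfl,
        ht.trans_produces ⟨r', hr', r'.rewrites_of_exists_parts p q⟩⟩
    · exact absurd hd h.1

/-- A string over the symbols of `Δ` without nonterminals is a word. -/
lemma exists_eq_map_terminal {T N : Type*} {t : List (Symbol T N)}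
    (h : ∀ n, Symbol.nonterminal n ∉ t) : ∃ x : List T, t = x.map Symbol.terminal := by
  suffices ∀ s ∈ t, ∃ a : T, Symbol.terminal a = s by
    obtain ⟨x, hx⟩ := (Set.range_list_map _).ge this
    exact ⟨x, hx.symm⟩
  rintro (a | n) hs
  · exact ⟨a, rfl⟩
  · exact absurd hs (h n)

lemma map_deltaSym_dW {A : Type} (Γ : Option A → ContextFreeGrammar.{0} A)
    (Δ : ContextFreeGrammar.{0} (DollarT A)) (p : Word A) :
    ((dW p).map Symbol.terminal).map (deltaSym Γ Δ) = dols Γ Δ p := by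
  cases p <;> simp [dW, dols, deltaSym]

lemma map_deltaSym_tdW {A : Type} (Γ : Option A → ContextFreeGrammar.{0} A)
    (Δ : ContextFreeGrammar.{0} (DollarT A)) (p : Word A) :
    ((tdW p).map Symbol.terminal).map (deltaSym Γ Δ) = tdols Γ Δ p := by
  cases p <;> simp [tdW, tdols, deltaSym]

lemma isOuterFree_of_mem_dols {A : Type} (Γ : Option A → ContextFreeGrammar.{0} A)
    (Δ : ContextFreeGrammar.{0} (DollarT A)) (p : Word A) :
    ∀ s ∈ dols Γ Δ p, IsOuterFree s := by
  cases p <;> simp [dols, IsOuterFree]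

lemma isOuterFree_of_mem_tdols {A : Type} (Γ : Option A → ContextFreeGrammar.{0} A)
    (Δ : ContextFreeGrammar.{0} (DollarT A)) (p : Word A) :
    ∀ s ∈ tdols Γ Δ p, IsOuterFree s := by
  cases p <;> simp [tdols, IsOuterFree]

/-- A word derived in `Θ` from symbols that are neither `#₂` nor nonterminals of `Δ` does not
contain `#₂`. -/
lemma exists_map_some_of_Theta_derives {A : Type} [Fintype A]
    (Γ : Option A → ContextFreeGrammar.{0} A) (Δ : ContextFreeGrammar.{0} (DollarT A))
    {s : List (Symbol (Option A) (ThetaNT A Γ Δ))} {w : List (Option A)}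
    (h : (Theta Γ Δ).Derives s (w.map Symbol.terminal)) (hs : ∀ x ∈ s, IsOuterFree x) :
    ∃ u : Word A, w = u.map some := by
  have hw : ∀ x ∈ w.map Symbol.terminal, IsOuterFree (Γ := Γ) (Δ := Δ) x := by
    refine ContextFreeGrammar.Derives.forall_mem (g := Theta Γ Δ)
      (P := IsOuterFree (Γ := Γ) (Δ := Δ)) (fun r hr hin => ?_) h (fun x hx => hs x hx)
    rcases Theta_rules_cases Γ Δ hr with ⟨r', -, rfl⟩ | h
    · exact absurd rfl (hin.2 r'.input)
    · exact h.2
  suffices ∀ x ∈ w, ∃ a : A, some a = x by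
    obtain ⟨u, hu⟩ := (Set.range_list_map _).ge this
    exact ⟨u, hu.symm⟩
  intro x hx
  cases x with
  | none => exact absurd rfl (hw _ (List.mem_map_of_mem hx)).1
  | some a => exact ⟨a, rfl⟩

/-- **Lemma 3.2.** If `w ∈ L(Θ)`, then `w = u #₂ vʳᵉᵛ` for some `u, v ∈ A*`, and there
exists `p ∈ A*` such that `$_p ⇒*_Θ u` and `$̃_{pʳᵉᵛ} ⇒*_Θ vʳᵉᵛ`. -/
theorem mem_language_Theta_decompose
    {A : Type} [Fintype A] (R : Set (Word A × Word A))
    (hconf : RWConfluent R) (hmon : RWMonadic R)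
    (Γ : Option A → ContextFreeGrammar.{0} A)
    (hΓ : ∀ a : Option A, (Γ a).language = {l : Word A | (l, toWord a) ∈ R})
    (hΓeps : ∀ a : Option A, ∀ r ∈ (Γ a).rules, r.output ≠ [])
    (Δ : ContextFreeGrammar.{0} (DollarT A))
    (hΔ : Δ.language =
      {x | ∃ p : Word A, x = dW p ++ [DollarT.hash] ++ tdW p.reverse}) :
    ∀ w ∈ (Theta Γ Δ).language,
      ∃ u v p : Word A,
        w = u.map some ++ [none] ++ (v.map some).reverse ∧
        (Theta Γ Δ).Derives (dols Γ Δ p) (terms Γ Δ u) ∧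
        (Theta Γ Δ).Derives (tdols Γ Δ p.reverse) ((terms Γ Δ v).reverse) := by
  intro w hw
  obtain ⟨s, hs, hsP, hsw⟩ := ContextFreeGrammar.Derives.exists_restrict (P := ThetaNT.IsDelta)
    (fun r hr hin n hn hmem => by
      rcases Theta_rules_cases Γ Δ hr with ⟨r', -, rfl⟩ | h
      · exact hin ⟨_, rfl⟩
      · obtain ⟨m, rfl⟩ := hn
        exact (h.2 _ hmem).2 m rfl)
    (((Theta Γ Δ).mem_language_iff w).1 hw) (by simp)
  obtain ⟨t, rfl, ht⟩ := exists_derives_of_restrict_Theta Γ Δ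
    (t := [.nonterminal Δ.initial]) hs
  obtain ⟨x, rfl⟩ := exists_eq_map_terminal (t := t) fun n hn =>
    hsP (.delta n) ⟨n, rfl⟩ (List.mem_map_of_mem (f := deltaSym Γ Δ) hn)
  have hx : x ∈ Δ.language := ht
  rw [hΔ] at hx
  obtain ⟨p, rfl⟩ := hx
  rw [List.map_append, List.map_append, List.map_append, List.map_append,
    map_deltaSym_dW, map_deltaSym_tdW] at hsw
  obtain ⟨w', w₂, hw₁, h', h₂⟩ := hsw.exists_append
  obtain ⟨w₁, m, rfl, h₁, hm⟩ := h'.exists_append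
  obtain ⟨w', w₂, rfl, hw', rfl⟩ := List.map_eq_append_iff.1 hw₁
  obtain ⟨w₁, m, rfl, rfl, rfl⟩ := List.map_eq_append_iff.1 hw'
  obtain ⟨u, rfl⟩ := exists_map_some_of_Theta_derives Γ Δ h₁ (isOuterFree_of_mem_dols Γ Δ p)
  obtain ⟨v, rfl⟩ := exists_map_some_of_Theta_derives Γ Δ h₂
    (isOuterFree_of_mem_tdols Γ Δ p.reverse)
  have hm' : m = [none] := by
    rcases hm.eq_or_head with h | ⟨_, hx, _⟩
    · have h' : m.map (Symbol.terminal (N := ThetaNT A Γ Δ)) = [none].map Symbol.terminal := h.symm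
      exact List.map_injective_iff.2 (fun _ _ => Symbol.terminal.inj) h'
    · obtain ⟨r, _, hr⟩ := hx.exists_nonterminal_input_mem
      cases List.mem_singleton.1 hr
  subst hm'
  refine ⟨u, v.reverse, p, by simp, ?_, ?_⟩
  · rw [List.map_map] at h₁
    exact h₁
  · rw [List.map_map] at h₂
    rw [terms, List.map_reverse, List.reverse_reverse]
    exact h₂
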